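/- Let f(x,y) = (x − y²)² + x⁶ on ℝ² and let (X_t, Y_t) be distributed with density proportional to e^{-f(x,y)/t}. Then (X_t/t^{1/6}, (Y_t² − X_t)/t^{1/2}) converges in law as t → 0⁺ to the distribution on ℝ² with density C · (e^{-x⁶}/√x) · (e^{-y²}/√π) · 1_{x ≥ 0}, where C = (∫₀^∞ e^{-x⁶} x^{-1/2} dx)^{-1}. -/

import Mathlib

open MeasureTheory Topology Filter

lemma aux_cov (F : ℝ × ℝ → ℝ) (b c : ℝ) (hb : 0 < b) (hc : 0 < c) :
    ∫ p : ℝ × ℝ, F p = b * c * ∫ q : ℝ × ℝ, F ((b * q.1) ^ 2 - c * q.2, b * q.1) := by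
  have h1 : ∫ p : ℝ × ℝ, F p = ∫ q : ℝ × ℝ, F (q.2, q.1) := by
    exact (integral_prod_swap (μ := (volume : Measure ℝ)) (ν := (volume : Measure ℝ)) F).symm
  have hinv : Function.Involutive (fun q : ℝ × ℝ => (q.1, q.1 ^ 2 - q.2)) := by
    intro q; simp
  have hmeas : Measurable (fun q : ℝ × ℝ => (q.1, q.1 ^ 2 - q.2)) := by fun_prop
  let e : (ℝ × ℝ) ≃ᵐ (ℝ × ℝ) := ⟨hinv.toPerm, hmeas, hmeas⟩
  have h2 : MeasurePreserving e ((volume : Measure ℝ).prod (volume : Measure ℝ))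
      ((volume : Measure ℝ).prod (volume : Measure ℝ)) := by
    refine (MeasurePreserving.id (volume : Measure ℝ)).skew_product
      (g := fun y v => y ^ 2 - v) (by fun_prop) ?_
    refine Eventually.of_forall fun y => ?_
    exact (Measure.measurePreserving_sub_left (volume : Measure ℝ) (y ^ 2)).map_eq
  have h3 : ∫ q : ℝ × ℝ, F (q.2, q.1) = ∫ q : ℝ × ℝ, F (q.1 ^ 2 - q.2, q.1) :=
    (h2.integral_comp' (fun q : ℝ × ℝ => F (q.2, q.1))).symm
  let d : (ℝ × ℝ) ≃ᵐ (ℝ × ℝ) :=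
    (MeasurableEquiv.mulLeft₀ b hb.ne').prodCongr (MeasurableEquiv.mulLeft₀ c hc.ne')
  have h4 : Measure.map d ((volume : Measure ℝ).prod (volume : Measure ℝ))
      = (ENNReal.ofReal (b⁻¹ * c⁻¹)) • ((volume : Measure ℝ).prod (volume : Measure ℝ)) := by
    have : Measure.map d ((volume : Measure ℝ).prod (volume : Measure ℝ))
      = (Measure.map (b * ·) (volume : Measure ℝ)).prod
        (Measure.map (c * ·) (volume : Measure ℝ)) :=
      (Measure.map_prod_map _ _ (measurable_const_mul b) (measurable_const_mul c)).symm
    rw [this, Real.map_volume_mul_left hb.ne', Real.map_volume_mul_left hc.ne',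
      Measure.prod_smul_left, Measure.prod_smul_right, smul_smul,
      abs_of_pos (inv_pos.2 hb), abs_of_pos (inv_pos.2 hc),
      ENNReal.ofReal_mul (inv_pos.2 hb).le]
  have h5 := integral_map_equiv (μ := (volume : Measure ℝ).prod (volume : Measure ℝ)) d
    (fun q : ℝ × ℝ => F (q.1 ^ 2 - q.2, q.1))
  rw [h4, integral_smul_measure, ENNReal.toReal_ofReal (by positivity)] at h5
  have h6 : ∫ q : ℝ × ℝ, F ((b * q.1) ^ 2 - c * q.2, b * q.1)
    = (b⁻¹ * c⁻¹) * ∫ q : ℝ × ℝ, F (q.1 ^ 2 - q.2, q.1) := h5.symm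
  rw [h1, h3, h6]
  field_simp

lemma aux_bound (s z v : ℝ) (hs : |s| ≤ 1) :
    Real.exp (-((z ^ 2 - s * v) ^ 6 + v ^ 2)) ≤
      Real.exp 2 * (Real.exp (-(1/3) * z ^ 2) * Real.exp (-(1/2) * v ^ 2)) := by
  rw [← Real.exp_add, ← Real.exp_add, Real.exp_le_exp]
  have h1 : ∀ a : ℝ, a ^ 2 - 1 ≤ a ^ 6 := by
    intro a
    nlinarith [sq_nonneg (a ^ 2 - 1), sq_nonneg (a * (a ^ 2 - 1)), sq_nonneg a]
  have h2 := h1 (z ^ 2 - s * v)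
  have h3 : (s * v) ^ 2 ≤ v ^ 2 := by
    rw [mul_pow]
    have : s ^ 2 ≤ 1 := (sq_le_one_iff_abs_le_one s).2 hs
    nlinarith [sq_nonneg v]
  nlinarith [sq_nonneg (2 * (z ^ 2 - s * v) - s * v), sq_nonneg (z ^ 2 - 1), sq_nonneg z]

lemma aux_int_bound : Integrable (fun q : ℝ × ℝ =>
      Real.exp 2 * (Real.exp (-(1/3) * q.1 ^ 2) * Real.exp (-(1/2) * q.2 ^ 2))) := by
  refine Integrable.const_mul ?_ _
  exact (integrable_exp_neg_mul_sq (b := 1/3) (by norm_num)).mul_prod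
    (integrable_exp_neg_mul_sq (b := 1/2) (by norm_num))

lemma aux_tendsto (φ : BoundedContinuousFunction (ℝ × ℝ) ℝ) :
    Tendsto (fun s : ℝ => ∫ q : ℝ × ℝ, φ (q.1 ^ 2 - s * q.2, q.2) *
        Real.exp (-((q.1 ^ 2 - s * q.2) ^ 6 + q.2 ^ 2))) (𝓝 0)
      (𝓝 (∫ q : ℝ × ℝ, φ (q.1 ^ 2, q.2) * Real.exp (-((q.1 ^ 2) ^ 6 + q.2 ^ 2)))) := by
  refine tendsto_integral_filter_of_dominated_convergence
    (fun q : ℝ × ℝ => ‖φ‖ * (Real.exp 2 *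
      (Real.exp (-(1/3) * q.1 ^ 2) * Real.exp (-(1/2) * q.2 ^ 2)))) ?_ ?_ ?_ ?_
  · refine Eventually.of_forall fun s => Continuous.aestronglyMeasurable ?_
    fun_prop
  · have : ∀ᶠ s : ℝ in 𝓝 0, |s| ≤ 1 := by
      have := Metric.closedBall_mem_nhds (0:ℝ) one_pos
      filter_upwards [this] with s hs
      simpa using hs
    filter_upwards [this] with s hs
    refine Eventually.of_forall fun q => ?_
    rw [norm_mul, Real.norm_of_nonneg (Real.exp_pos _).le]
    exact mul_le_mul (φ.norm_coe_le_norm _) (aux_bound s q.1 q.2 hs) (Real.exp_pos _).le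
      (norm_nonneg _)
  · exact aux_int_bound.const_mul _
  · refine Eventually.of_forall fun q => ?_
    have hc : Continuous (fun s : ℝ => φ (q.1 ^ 2 - s * q.2, q.2) *
        Real.exp (-((q.1 ^ 2 - s * q.2) ^ 6 + q.2 ^ 2))) := by fun_prop
    have := hc.tendsto 0
    simpa using this

lemma aux_int0 (φ : BoundedContinuousFunction (ℝ × ℝ) ℝ) :
    Integrable (fun q : ℝ × ℝ => φ (q.1 ^ 2, q.2) * Real.exp (-((q.1 ^ 2) ^ 6 + q.2 ^ 2))) := by
  refine (aux_int_bound.const_mul ‖φ‖).mono' (Continuous.aestronglyMeasurable (by fun_prop)) ?_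
  refine Eventually.of_forall fun q => ?_
  rw [norm_mul, Real.norm_of_nonneg (Real.exp_pos _).le]
  have := aux_bound 0 q.1 q.2 (by simp)
  rw [zero_mul, sub_zero] at this
  exact mul_le_mul (φ.norm_coe_le_norm _) this (Real.exp_pos _).le (norm_nonneg _)

lemma aux_sq (h : ℝ → ℝ) :
    ∫ z : ℝ, h (z ^ 2) = ∫ w in Set.Ioi (0:ℝ), h w / Real.sqrt w := by
  have h1 := integral_comp_abs (f := fun z => h (z ^ 2))
  simp only [sq_abs] at h1
  have h2 := integral_comp_rpow_Ioi (fun w => h w / Real.sqrt w) (p := 2) (by norm_num)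
  rw [h1, ← h2, ← integral_const_mul]
  refine setIntegral_congr_fun measurableSet_Ioi fun z hz => ?_
  have hz' : (0:ℝ) < z := hz
  have e1 : z ^ (2:ℝ) = z ^ 2 := Real.rpow_two z
  have e2 : z ^ ((2:ℝ) - 1) = z := by norm_num
  simp only [e1, e2, Real.sqrt_sq hz'.le, smul_eq_mul]
  rw [abs_of_pos (by norm_num : (0:ℝ) < 2)]
  field_simp

lemma aux_intA : IntegrableOn (fun x : ℝ => Real.exp (-x ^ 6) / Real.sqrt x) (Set.Ioi 0) := by
  have := integrableOn_rpow_mul_exp_neg_rpow (s := -1/2) (p := 6) (by norm_num) (by norm_num)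
  refine this.congr_fun (fun x hx => ?_) measurableSet_Ioi
  have hx' : (0:ℝ) < x := hx
  have e1 : x ^ (6:ℝ) = x ^ 6 := by exact_mod_cast Real.rpow_natCast x 6
  have e2 : x ^ (-1/2 : ℝ) = (Real.sqrt x)⁻¹ := by
    rw [Real.sqrt_eq_rpow, ← Real.rpow_neg hx'.le]; norm_num
  simp only [e1, e2]
  ring

lemma aux_intE : Integrable (fun x : ℝ => Real.exp (-x ^ 2)) := by
  simpa using integrable_exp_neg_mul_sq (b := 1) (by norm_num)

lemma aux_limit (φ : BoundedContinuousFunction (ℝ × ℝ) ℝ) :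
    ∫ q : ℝ × ℝ, φ (q.1 ^ 2, q.2) * Real.exp (-((q.1 ^ 2) ^ 6 + q.2 ^ 2))
    = ∫ p : ℝ × ℝ, φ p * ((Set.Ioi (0:ℝ)).indicator
        (fun x => Real.exp (-x ^ 6) / Real.sqrt x) p.1 * Real.exp (-p.2 ^ 2)) := by
  have hi : Integrable (fun p : ℝ × ℝ => φ p * ((Set.Ioi (0:ℝ)).indicator
        (fun x => Real.exp (-x ^ 6) / Real.sqrt x) p.1 * Real.exp (-p.2 ^ 2))) := by
    have := ((integrable_indicator_iff measurableSet_Ioi).2 aux_intA).mul_prod aux_intE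
    exact this.bdd_mul (c := ‖φ‖) φ.continuous.aestronglyMeasurable
      (Eventually.of_forall fun p => φ.norm_coe_le_norm p)
  rw [Measure.volume_eq_prod] at hi ⊢
  rw [integral_prod_symm _ (aux_int0 φ), integral_prod_symm _ hi]
  congr 1
  ext v
  rw [aux_sq (fun w => φ (w, v) * Real.exp (-(w ^ 6 + v ^ 2))), ← integral_indicator measurableSet_Ioi]
  congr 1
  ext w
  by_cases hw : w ∈ Set.Ioi (0:ℝ)
  · simp only [Set.indicator_of_mem hw]
    rw [neg_add, Real.exp_add]; ring
  · simp only [Set.indicator_of_notMem hw]; ring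

lemma aux_scale (φ : BoundedContinuousFunction (ℝ × ℝ) ℝ) (t : ℝ) (ht : 0 < t) :
    ∫ p : ℝ × ℝ, φ (p.1 / t ^ ((1:ℝ) / 6), (p.2 ^ 2 - p.1) / t ^ ((1:ℝ) / 2)) *
            Real.exp (-((p.1 - p.2 ^ 2) ^ 2 + p.1 ^ 6) / t)
    = t ^ ((1:ℝ)/12) * t ^ ((1:ℝ)/2) * ∫ q : ℝ × ℝ, φ (q.1 ^ 2 - t ^ ((1:ℝ)/3) * q.2, q.2) *
        Real.exp (-((q.1 ^ 2 - t ^ ((1:ℝ)/3) * q.2) ^ 6 + q.2 ^ 2)) := by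
  obtain ⟨r, hr, rfl⟩ : ∃ r : ℝ, 0 < r ∧ t = r ^ 12 := by
    refine ⟨t ^ ((1:ℝ)/12), by positivity, ?_⟩
    rw [← Real.rpow_natCast, ← Real.rpow_mul ht.le]; norm_num
  have key : ∀ (a : ℝ) (n : ℕ), 12 * a = n → (r ^ 12) ^ a = r ^ n := by
    intro a n h
    rw [← Real.rpow_natCast r 12, ← Real.rpow_mul hr.le, ← Real.rpow_natCast]
    congr 1
  rw [key (1/6) 2 (by norm_num), key (1/2) 6 (by norm_num), key (1/3) 4 (by norm_num),
    key (1/12) 1 (by norm_num)]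
  rw [aux_cov _ (r ^ 1) (r ^ 6) (by positivity) (by positivity)]
  congr 2
  ext q
  have e1 : ((r ^ 1 * q.1) ^ 2 - r ^ 6 * q.2) / r ^ 2 = q.1 ^ 2 - r ^ 4 * q.2 := by
    field_simp
  have e2 : ((r ^ 1 * q.1) ^ 2 - ((r ^ 1 * q.1) ^ 2 - r ^ 6 * q.2)) / r ^ 6 = q.2 := by
    field_simp; ring
  have e3 : -((((r ^ 1 * q.1) ^ 2 - r ^ 6 * q.2) - (r ^ 1 * q.1) ^ 2) ^ 2
      + ((r ^ 1 * q.1) ^ 2 - r ^ 6 * q.2) ^ 6) / r ^ 12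
      = -((q.1 ^ 2 - r ^ 4 * q.2) ^ 6 + q.2 ^ 2) := by
    field_simp; ring
  simp only [e1, e2, e3]


/-- Non-coercive example f(x,y) = (x − y²)² + x⁶: if (X_t,Y_t) ~ C_t e^{-f/t},
then (X_t/t^{1/6}, (Y_t² − X_t)/t^{1/2}) converges in law to the measure with density
C e^{-x⁶}/√x · e^{-y²}/√π on {x ≥ 0}. Convergence in law is stated against bounded
continuous test functions. -/
theorem stmt16 (φ : BoundedContinuousFunction (ℝ × ℝ) ℝ) :
    Tendsto (fun t : ℝ =>
        (∫ p : ℝ × ℝ, φ (p.1 / t ^ ((1:ℝ) / 6), (p.2 ^ 2 - p.1) / t ^ ((1:ℝ) / 2)) *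
            Real.exp (-((p.1 - p.2 ^ 2) ^ 2 + p.1 ^ 6) / t)) /
          ∫ p : ℝ × ℝ, Real.exp (-((p.1 - p.2 ^ 2) ^ 2 + p.1 ^ 6) / t))
      (𝓝[>] 0)
      (𝓝 (∫ p : ℝ × ℝ, φ p *
        (if 0 ≤ p.1 then
          (∫ x in Set.Ioi (0:ℝ), Real.exp (-x ^ 6) / Real.sqrt x)⁻¹ *
            (Real.exp (-p.1 ^ 6) / Real.sqrt p.1) *
            (Real.exp (-p.2 ^ 2) / Real.sqrt Real.pi)
         else 0))) := by

  set A : ℝ := ∫ x in Set.Ioi (0:ℝ), Real.exp (-x ^ 6) / Real.sqrt x with hA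
  set J : BoundedContinuousFunction (ℝ × ℝ) ℝ → ℝ := fun ψ =>
    ∫ q : ℝ × ℝ, ψ (q.1 ^ 2, q.2) * Real.exp (-((q.1 ^ 2) ^ 6 + q.2 ^ 2)) with hJ
  have hJ1 : J 1 = A * Real.sqrt Real.pi := by
    rw [hJ]
    simp only
    rw [aux_limit 1]
    simp only [BoundedContinuousFunction.coe_one, Pi.one_apply, one_mul]
    rw [Measure.volume_eq_prod, integral_prod_mul ((Set.Ioi (0:ℝ)).indicator
      (fun x : ℝ => Real.exp (-x ^ 6) / Real.sqrt x)) (fun y : ℝ => Real.exp (-y ^ 2)), integral_indicator measurableSet_Ioi]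
    have := integral_gaussian 1
    simp only [neg_mul, one_mul, div_one] at this
    rw [this]
  have hJpos : 0 < J 1 := by
    have h := aux_int0 1
    simp only [BoundedContinuousFunction.coe_one, Pi.one_apply, one_mul] at h
    have := integral_exp_pos h
    simpa [hJ] using this
  have hlim : (∫ p : ℝ × ℝ, φ p *
        (if 0 ≤ p.1 then A⁻¹ * (Real.exp (-p.1 ^ 6) / Real.sqrt p.1) *
            (Real.exp (-p.2 ^ 2) / Real.sqrt Real.pi) else 0)) = J φ / J 1 := by
    rw [hJ1, hJ]
    simp only
    rw [aux_limit φ, div_eq_inv_mul, ← integral_const_mul]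
    congr 1
    ext p
    rcases lt_trichotomy p.1 0 with h | h | h
    · simp [h.not_ge, Set.indicator, h.le.not_gt]
    · simp [h, Set.indicator]
    · rw [if_pos h.le, Set.indicator_of_mem (show p.1 ∈ Set.Ioi (0:ℝ) from h), mul_inv]
      ring
  rw [hlim]
  have hs : Tendsto (fun t : ℝ => t ^ ((1:ℝ)/3)) (𝓝[>] 0) (𝓝 0) := by
    have : Tendsto (fun t : ℝ => t ^ ((1:ℝ)/3)) (𝓝 0) (𝓝 ((0:ℝ) ^ ((1:ℝ)/3))) :=
      (Real.continuousAt_rpow_const 0 _ (Or.inr (by norm_num))).tendsto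
    rw [Real.zero_rpow (by norm_num)] at this
    exact this.mono_left nhdsWithin_le_nhds
  have hT := ((aux_tendsto φ).comp hs).div ((aux_tendsto 1).comp hs) hJpos.ne'
  refine hT.congr' ?_
  filter_upwards [self_mem_nhdsWithin] with t ht
  have ht' : (0:ℝ) < t := ht
  have h1 := aux_scale 1 t ht'
  simp only [BoundedContinuousFunction.coe_one, Pi.one_apply, one_mul] at h1
  rw [aux_scale φ t ht', h1, mul_div_mul_left _ _ (by positivity)]
  simp
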